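/- arXiv:2208.03788 — 4 statements merged into one kernel-verified Lean document; each statement's English description precedes it below -/
import Mathlib

section
/- Let m, n ≥ 3 be natural numbers, both even. Then M(P_m × P_n) ∈ {r, r+1}, where r = mn(m+n)/2 − 3. -/
/-- The Manhattan distance between two vertices of the grid graph `P_m × P_n`. -/
def gridDist {m n : ℕ} (p q : Fin m × Fin n) : ℕ :=
  Nat.dist p.1 q.1 + Nat.dist p.2 q.2

/-- The length of the walk induced by a labeling (bijection) `σ` of the vertices of
`P_m × P_n` by `{1, …, mn}`: the sum of Manhattan distances between consecutively
labeled vertices. -/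
def walkLen (m n : ℕ) (σ : Fin m × Fin n ≃ Fin (m * n)) : ℕ :=
  ∑ t : Fin (m * n - 1),
    gridDist (σ.symm (t.castLE (by omega))) (σ.symm ⟨t.val + 1, by omega⟩)

/-- `M(P_m × P_n)`: the maximal length of a walk induced by a labeling of `P_m × P_n`. -/
noncomputable def maxWalk (m n : ℕ) : ℕ := sSup (Set.range (walkLen m n))

/-- Twice the Manhattan distance from a vertex to the centre of the grid. -/
def centerDist {m n : ℕ} (p : Fin m × Fin n) : ℕ :=
  Nat.dist (2 * p.1 + 1) m + Nat.dist (2 * p.2 + 1) n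

theorem two_mul_gridDist_le {m n : ℕ} (p q : Fin m × Fin n) :
    2 * gridDist p q ≤ centerDist p + centerDist q := by
  simp only [gridDist, centerDist, Nat.dist]
  omega

theorem two_le_centerDist {m n : ℕ} (hm : Even m) (hn : Even n) (p : Fin m × Fin n) :
    2 ≤ centerDist p := by
  obtain ⟨a, rfl⟩ := hm
  obtain ⟨b, rfl⟩ := hn
  simp only [centerDist, Nat.dist]
  omega

theorem sum_range_dist_center (a : ℕ) :
    ∑ i ∈ Finset.range (a + a), Nat.dist (2 * i + 1) (a + a) = 2 * a * a := by
  induction a with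
  | zero => simp
  | succ a ih =>
    have h : ∀ i, Nat.dist (2 * (i + 1) + 1) (a + 1 + (a + 1)) = Nat.dist (2 * i + 1) (a + a) := by
      intro i
      simp only [Nat.dist]
      omega
    rw [show a + 1 + (a + 1) = a + a + 1 + 1 by ring, Finset.sum_range_succ,
      Finset.sum_range_succ', show a + a + 1 + 1 = a + 1 + (a + 1) by ring]
    simp only [h, ih]
    have h₀ : Nat.dist (2 * 0 + 1) (a + 1 + (a + 1)) = 2 * a + 1 := by
      simp only [Nat.dist]
      omega
    have h₁ : Nat.dist (2 * (a + a) + 1) (a + a) = 2 * a + 1 := by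
      simp only [Nat.dist]
      omega
    rw [h₀, h₁]
    ring

theorem sum_centerDist (a b : ℕ) :
    ∑ p : Fin (a + a) × Fin (b + b), centerDist p = 4 * (a * b) * (a + b) := by
  simp only [centerDist, Fintype.sum_prod_type, Finset.sum_add_distrib, Finset.sum_const,
    Finset.card_univ, Fintype.card_fin, smul_eq_mul, ← Finset.mul_sum]
  rw [Fin.sum_univ_eq_sum_range (fun i => Nat.dist (2 * i + 1) (a + a)),
    Fin.sum_univ_eq_sum_range (fun i => Nat.dist (2 * i + 1) (b + b)),
    sum_range_dist_center, sum_range_dist_center]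
  ring

theorem sum_consecutive_add_ends {N : ℕ} (hN : 0 < N) (g : Fin N → ℕ) :
    ∑ t : Fin (N - 1), (g (t.castLE (by omega)) + g ⟨t.val + 1, by omega⟩)
      + g ⟨0, hN⟩ + g ⟨N - 1, by omega⟩ = 2 * ∑ t, g t := by
  obtain ⟨k, rfl⟩ : ∃ k, N = k + 1 := ⟨N - 1, by omega⟩
  have h₁ := Fin.sum_univ_succ g
  have h₂ := Fin.sum_univ_castSucc g
  rw [Finset.sum_add_distrib]
  change ∑ t : Fin k, g t.castSucc + ∑ t : Fin k, g t.succ + g 0 + g (Fin.last k) = _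
  omega

theorem sum_consecutive_centerDist {a b : ℕ} (hN : 0 < (a + a) * (b + b))
    (σ : Fin (a + a) × Fin (b + b) ≃ Fin ((a + a) * (b + b))) :
    ∑ t : Fin ((a + a) * (b + b) - 1),
        (centerDist (σ.symm (t.castLE (by omega))) + centerDist (σ.symm ⟨t.val + 1, by omega⟩))
      + centerDist (σ.symm ⟨0, hN⟩) + centerDist (σ.symm ⟨(a + a) * (b + b) - 1, by omega⟩)
      = 8 * (a * b) * (a + b) := by
  rw [sum_consecutive_add_ends hN fun t => centerDist (σ.symm t),
    Equiv.sum_comp σ.symm centerDist, sum_centerDist]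
  ring

theorem walkLen_add_two_le {a b : ℕ} (hN : 0 < (a + a) * (b + b))
    (σ : Fin (a + a) × Fin (b + b) ≃ Fin ((a + a) * (b + b))) :
    walkLen (a + a) (b + b) σ + 2 ≤ 4 * (a * b) * (a + b) := by
  have h := sum_consecutive_centerDist hN σ
  have h₀ := two_le_centerDist (Even.add_self a) (Even.add_self b) (σ.symm ⟨0, hN⟩)
  have h₁ := two_le_centerDist (Even.add_self a) (Even.add_self b)
    (σ.symm ⟨(a + a) * (b + b) - 1, by omega⟩)
  have hle : 2 * walkLen (a + a) (b + b) σ ≤ ∑ t : Fin ((a + a) * (b + b) - 1),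
      (centerDist (σ.symm (t.castLE (by omega))) +
        centerDist (σ.symm ⟨t.val + 1, by omega⟩)) := by
    rw [walkLen, Finset.mul_sum]
    exact Finset.sum_le_sum fun t _ => two_mul_gridDist_le _ _
  have : 8 * (a * b) * (a + b) = 2 * (4 * (a * b) * (a + b)) := by ring
  omega

/-- Row visited at time `t` by a walk that alternates first between one pair of opposite
quadrants and then between the other pair. -/
def zigzagRow (a b t : ℕ) : ℕ :=
  (if t / 2 / b < a then t / 2 / b else t / 2 / b - a) + (if t % 2 = 0 then a else 0)

/-- Column visited at time `t` by the walk of `zigzagRow`. -/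
def zigzagCol (a b t : ℕ) : ℕ :=
  if t / 2 / b < a then t / 2 % b + (if t % 2 = 0 then b else 0)
  else if t % 2 = 0 then t / 2 % b else b + b - 1 - t / 2 % b

theorem half_div_lt {a b t : ℕ} (hb : 0 < b) (ht : t < (a + a) * (b + b)) :
    t / 2 / b < a + a := by
  rw [Nat.div_lt_iff_lt_mul hb]
  have : (a + a) * (b + b) = 2 * ((a + a) * b) := by ring
  omega

theorem zigzagRow_lt {a b t : ℕ} (hb : 0 < b) (ht : t < (a + a) * (b + b)) :
    zigzagRow a b t < a + a := by
  have := half_div_lt hb ht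
  unfold zigzagRow
  split_ifs <;> omega

theorem zigzagCol_lt {a b : ℕ} (hb : 0 < b) (t : ℕ) : zigzagCol a b t < b + b := by
  have := Nat.mod_lt (t / 2) hb
  unfold zigzagCol
  split_ifs <;> omega

theorem zigzag_inj {a b t u : ℕ} (hb : 0 < b) (ht : t < (a + a) * (b + b))
    (hu : u < (a + a) * (b + b)) (hrow : zigzagRow a b t = zigzagRow a b u)
    (hcol : zigzagCol a b t = zigzagCol a b u) : t = u := by
  have ht' := half_div_lt hb ht
  have hu' := half_div_lt hb hu
  have htm := Nat.mod_lt (t / 2) hb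
  have hum := Nat.mod_lt (u / 2) hb
  unfold zigzagRow at hrow
  unfold zigzagCol at hcol
  have key : t / 2 / b = u / 2 / b ∧ t / 2 % b = u / 2 % b ∧ t % 2 = u % 2 := by
    generalize t / 2 / b = q at *
    generalize u / 2 / b = q' at *
    generalize t / 2 % b = j at *
    generalize u / 2 % b = j' at *
    split_ifs at hrow hcol <;> omega
  have h₁ := Nat.div_add_mod (t / 2) b
  have h₂ := Nat.div_add_mod (u / 2) b
  rw [key.1, key.2.1] at h₁
  omega

/-- The vertex visited at time `t` by the walk of `zigzagRow` and `zigzagCol`. -/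
def zigzag {a b : ℕ} (hb : 0 < b) (t : Fin ((a + a) * (b + b))) : Fin (a + a) × Fin (b + b) :=
  (⟨zigzagRow a b t, zigzagRow_lt hb t.isLt⟩, ⟨zigzagCol a b t, zigzagCol_lt hb t⟩)

theorem zigzag_bijective {a b : ℕ} (hb : 0 < b) :
    Function.Bijective (zigzag (a := a) hb) := by
  rw [Fintype.bijective_iff_injective_and_card]
  refine ⟨fun t u h => ?_, by simp⟩
  simp only [zigzag, Prod.mk.injEq, Fin.mk.injEq] at h
  exact Fin.ext (zigzag_inj hb t.isLt u.isLt h.1 h.2)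

theorem mul_sub_one_div_mod {a b : ℕ} (ha : 0 < a) (hb : 0 < b) :
    (a * b - 1) / b = a - 1 ∧ (a * b - 1) % b = b - 1 := by
  rw [Nat.div_mod_unique hb]
  obtain ⟨a, rfl⟩ : ∃ k, a = k + 1 := ⟨a - 1, by omega⟩
  have : (a + 1) * b = b * a + b := by ring
  simp only [Nat.add_sub_cancel]
  omega

theorem two_mul_gridDist_zigzag {a b : ℕ} (ha : 0 < a) (hb : 0 < b)
    (t u : Fin ((a + a) * (b + b))) (htu : u.val = t.val + 1) :
    2 * gridDist (zigzag hb t) (zigzag hb u) + (if t.val = 2 * (a * b) - 1 then 2 else 0) =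
      centerDist (zigzag hb t) + centerDist (zigzag hb u) := by
  have ht' := half_div_lt hb t.isLt
  have hu' := half_div_lt hb u.isLt
  have htm := Nat.mod_lt (t / 2) hb
  have hum := Nat.mod_lt (u / 2) hb
  have htc := Nat.div_lt_iff_lt_mul (x := t / 2) (y := a) hb
  have huc := Nat.div_lt_iff_lt_mul (x := u / 2) (y := a) hb
  have hpos := Nat.mul_pos ha hb
  simp only [gridDist, centerDist, zigzag, zigzagRow, zigzagCol, Nat.dist]
  generalize t.val = t at *
  generalize u.val = u at *
  subst htu
  by_cases hs : t = 2 * (a * b) - 1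
  · have h₁ : t / 2 = a * b - 1 := by omega
    have h₂ : (t + 1) / 2 = a * b := by omega
    obtain ⟨h₃, h₄⟩ := mul_sub_one_div_mod ha hb
    have h₅ : t % 2 = 1 := by omega
    have h₆ : (t + 1) % 2 = 0 := by omega
    simp only [h₁, h₂, h₃, h₄, h₅, h₆, Nat.mul_div_cancel a hb, Nat.mul_mod_left, if_pos hs]
    simp only [lt_irrefl, if_false, if_true, one_ne_zero, if_pos (Nat.sub_one_lt_of_lt ha)]
    clear htc huc
    omega
  · rw [if_neg hs]
    rcases Nat.mod_two_eq_zero_or_one t with h | h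
    · have h₂ : (t + 1) / 2 = t / 2 := by omega
      have h₆ : (t + 1) % 2 = 1 := by omega
      simp only [h, h₂, h₆, if_true, one_ne_zero, if_false]
      clear htc huc
      generalize t / 2 / b = q at *
      generalize t / 2 % b = j at *
      split_ifs <;> omega
    · have h₆ : (t + 1) % 2 = 0 := by omega
      have hiff : t / 2 / b < a ↔ (t + 1) / 2 / b < a := by
        rw [htc, huc]
        omega
      clear htc huc
      simp only [h, h₆, if_true, one_ne_zero, if_false]
      generalize t / 2 / b = q at *
      generalize t / 2 % b = j at *
      generalize (t + 1) / 2 / b = q' at *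
      generalize (t + 1) / 2 % b = j' at *
      by_cases hq : q < a
      · have hq' := hiff.1 hq
        simp only [if_pos hq, if_pos hq']
        omega
      · have hq' := mt hiff.2 hq
        simp only [if_neg hq, if_neg hq']
        omega

theorem exists_walkLen_add_three_eq {a b : ℕ} (ha : 0 < a) (hb : 0 < b) :
    ∃ σ, walkLen (a + a) (b + b) σ + 3 = 4 * (a * b) * (a + b) := by
  have hpos := Nat.mul_pos ha hb
  have hmul : (a + a) * (b + b) = 4 * (a * b) := by ring
  have hN : 0 < (a + a) * (b + b) := by omega
  let σ := (Equiv.ofBijective _ (zigzag_bijective (a := a) hb)).symm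
  refine ⟨σ, ?_⟩
  have h := sum_consecutive_centerDist hN σ
  have hσ : ∀ t, σ.symm t = zigzag hb t := fun _ => rfl
  have h₀ : centerDist (σ.symm ⟨0, hN⟩) = 2 := by
    simp only [hσ, zigzag, centerDist, zigzagRow, zigzagCol, Nat.dist, Nat.zero_div,
      Nat.zero_mod, if_pos ha, if_true]
    omega
  have h₁ : centerDist (σ.symm ⟨(a + a) * (b + b) - 1, by omega⟩) = 2 := by
    obtain ⟨h₃, h₄⟩ := mul_sub_one_div_mod (a := a + a) (by omega) hb
    have h₅ : ((a + a) * (b + b) - 1) / 2 = (a + a) * b - 1 := by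
      have : (a + a) * b = 2 * (a * b) := by ring
      omega
    have h₆ : ((a + a) * (b + b) - 1) % 2 = 1 := by omega
    simp only [hσ, zigzag, centerDist, zigzagRow, zigzagCol, Nat.dist, h₅, h₃, h₄, h₆,
      one_ne_zero, if_false]
    rw [if_neg (by omega), if_neg (by omega)]
    omega
  have hsum : 2 * walkLen (a + a) (b + b) σ + 2 = ∑ t : Fin ((a + a) * (b + b) - 1),
      (centerDist (σ.symm (t.castLE (by omega))) +
        centerDist (σ.symm ⟨t.val + 1, by omega⟩)) := by
    have hone : ∑ t : Fin ((a + a) * (b + b) - 1),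
        (if t.val = 2 * (a * b) - 1 then 2 else 0) = 2 := by
      rw [Fin.sum_univ_eq_sum_range (fun t => if t = 2 * (a * b) - 1 then 2 else 0),
        Finset.sum_ite_eq', if_pos (Finset.mem_range.2 (by omega))]
    refine (congrArg _ hone.symm).trans ?_
    rw [walkLen, Finset.mul_sum, ← Finset.sum_add_distrib]
    exact Finset.sum_congr rfl fun t _ => two_mul_gridDist_zigzag ha hb _ _ rfl
  have : 8 * (a * b) * (a + b) = 2 * (4 * (a * b) * (a + b)) := by ring
  omega

theorem maxWalk_even_even (m n : ℕ) (hm : 3 ≤ m) (hn : 3 ≤ n)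
    (hme : Even m) (hne : Even n) :
    maxWalk m n ∈
      ({m * n * (m + n) / 2 - 3, m * n * (m + n) / 2 - 3 + 1} : Set ℕ) := by
  obtain ⟨a, rfl⟩ := hme
  obtain ⟨b, rfl⟩ := hne
  have hN : 0 < (a + a) * (b + b) := by positivity
  obtain ⟨σ, hσ⟩ := exists_walkLen_add_three_eq (a := a) (b := b) (by omega) (by omega)
  have hupper : 4 * (a * b) * (a + b) - 2 ∈ upperBounds (Set.range (walkLen (a + a) (b + b))) := by
    rintro _ ⟨τ, rfl⟩
    have := walkLen_add_two_le hN τ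
    omega
  have hle : maxWalk (a + a) (b + b) ≤ 4 * (a * b) * (a + b) - 2 :=
    csSup_le ⟨_, σ, rfl⟩ hupper
  have hge : walkLen (a + a) (b + b) σ ≤ maxWalk (a + a) (b + b) :=
    le_csSup ⟨_, hupper⟩ ⟨σ, rfl⟩
  have hr : (a + a) * (b + b) * (a + a + (b + b)) / 2 = 4 * (a * b) * (a + b) := by
    rw [show (a + a) * (b + b) * (a + a + (b + b)) = 4 * (a * b) * (a + b) * 2 by ring,
      Nat.mul_div_cancel _ two_pos]
  rw [hr, Set.mem_insert_iff, Set.mem_singleton_iff]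
  omega
end

section
/- Let m, n ≥ 2 be natural numbers and let σ : V → [mn] be any bijection, where V = {(i,j) : i ∈ [m], j ∈ [n]}. Then Σ_{t=1}^{mn−1} d(σ⁻¹(t), σ⁻¹(t+1)) ≤ 2n⌊m/2⌋⌈m/2⌉ − 1_{m even} + 2m⌊n/2⌋⌈n/2⌉ − 1_{n even}, where 1_{k even} equals 1 if k is even and 0 otherwise. -/
open Finset

/-- Twice the distance of `i` from the centre `(m - 1) / 2` of `{0, …, m - 1}`, summed over `i`. -/
lemma sum_dist_two_mul (m : ℕ) :
    ∑ i ∈ range m, Nat.dist (2 * i) (m - 1) = 2 * (m / 2) * ((m + 1) / 2) := by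
  induction m using Nat.twoStepInduction with
  | zero => simp
  | one => simp [Nat.dist]
  | more m ih _ =>
    have shift : ∑ i ∈ range m, Nat.dist (2 * (i + 1)) (m + 1) =
        ∑ i ∈ range m, Nat.dist (2 * i) (m - 1) := by
      refine sum_congr rfl fun i hi => ?_
      have := mem_range.1 hi
      unfold Nat.dist
      omega
    have h₁ : (m + 2) / 2 = m / 2 + 1 := by omega
    have h₂ : (m + 2 + 1) / 2 = (m + 1) / 2 + 1 := by omega
    have h₃ : m / 2 + (m + 1) / 2 = m := by omega
    have h₄ : Nat.dist (2 * 0) (m + 1) + Nat.dist (2 * (m + 1)) (m + 1) = 2 * m + 2 := by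
      unfold Nat.dist
      omega
    rw [sum_range_succ, sum_range_succ', show m + 2 - 1 = m + 1 by omega, shift, ih, h₁, h₂,
      add_assoc, h₄]
    nth_rw 3 [← h₃]
    ring

/-- The total variation of a sequence in `Fin m` is bounded through distances to the centre. -/
lemma sum_dist_succ_add_le {m N : ℕ} (hN : 0 < N) (x : Fin N → Fin m) :
    ∑ t : Fin (N - 1), Nat.dist (x (t.castLE (by omega))) (x ⟨t.val + 1, by omega⟩) +
      (if Even m then 1 else 0) ≤ ∑ t, Nat.dist (2 * x t) (m - 1) := by
  obtain ⟨k, rfl⟩ : ∃ k, N = k + 1 := ⟨N - 1, by omega⟩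
  change ∑ t : Fin k, Nat.dist (x t.castSucc) (x t.succ) + _ ≤ _
  set w : Fin (k + 1) → ℕ := fun t => Nat.dist (2 * x t) (m - 1) with hw
  have triangle : 2 * ∑ t : Fin k, Nat.dist (x t.castSucc) (x t.succ) ≤
      ∑ t : Fin k, w t.castSucc + ∑ t : Fin k, w t.succ := by
    rw [mul_sum, ← sum_add_distrib]
    refine sum_le_sum fun t _ => ?_
    simp only [hw, Nat.dist]
    omega
  have h_end (t : Fin (k + 1)) : (if Even m then 1 else 0) ≤ w t := by
    split_ifs with he
    · obtain ⟨r, rfl⟩ := he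
      have := (x t).isLt
      simp only [hw, Nat.dist]
      omega
    · exact Nat.zero_le _
  have h₁ : ∑ t, w t = _ := Fin.sum_univ_castSucc w
  have h₂ : ∑ t, w t = _ := Fin.sum_univ_succ w
  have h₃ := h_end 0
  have h₄ := h_end (Fin.last k)
  change _ ≤ ∑ t, w t
  omega

theorem walkLen_le (m n : ℕ) (hm : 2 ≤ m) (hn : 2 ≤ n)
    (σ : Fin m × Fin n ≃ Fin (m * n)) :
    walkLen m n σ ≤
      (2 * n * (m / 2) * ((m + 1) / 2) - (if Even m then 1 else 0)) +
      (2 * m * (n / 2) * ((n + 1) / 2) - (if Even n then 1 else 0)) := by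
  have hN : 0 < m * n := by positivity
  have h₁ := sum_dist_succ_add_le hN fun t => (σ.symm t).1
  have h₂ := sum_dist_succ_add_le hN fun t => (σ.symm t).2
  have e₁ : ∑ t, Nat.dist (2 * (σ.symm t).1) (m - 1) = 2 * n * (m / 2) * ((m + 1) / 2) := by
    rw [σ.symm.sum_comp fun p => Nat.dist (2 * p.1) (m - 1), Fintype.sum_prod_type]
    simp only [sum_const, card_univ, Fintype.card_fin, smul_eq_mul, ← mul_sum]
    rw [Fin.sum_univ_eq_sum_range (fun i => Nat.dist (2 * i) (m - 1)), sum_dist_two_mul]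
    ring
  have e₂ : ∑ t, Nat.dist (2 * (σ.symm t).2) (n - 1) = 2 * m * (n / 2) * ((n + 1) / 2) := by
    rw [σ.symm.sum_comp fun p => Nat.dist (2 * p.2) (n - 1), Fintype.sum_prod_type]
    simp only [sum_const, card_univ, Fintype.card_fin, smul_eq_mul]
    rw [Fin.sum_univ_eq_sum_range (fun i => Nat.dist (2 * i) (n - 1)), sum_dist_two_mul]
    ring
  rw [e₁] at h₁
  rw [e₂] at h₂
  simp only [walkLen, gridDist, sum_add_distrib]
  exact add_le_add (Nat.le_sub_of_add_le h₁) (Nat.le_sub_of_add_le h₂)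
end

section
/- Let n ≥ 2 be an odd natural number and let m = 2. Then there exists a bijection σ : V → [2n], where V = {(i,j) : i ∈ [2], j ∈ [n]}, such that Σ_{t=1}^{2n−1} d(σ⁻¹(t), σ⁻¹(t+1)) = (n+1)² − 4. -/
/-- The column visited at time `s` of one sweep through the `2 * k + 1` columns: the sweep starts
in the middle column `k` and then alternates between the right and the left half. -/
def sweepColumn (k s : ℕ) : ℕ :=
  if s = 0 then k else if s % 2 = 1 then k + 1 + s / 2 else s / 2 - 1

/-- The column visited at time `t` of two successive sweeps. -/
def doubleSweepColumn (k t : ℕ) : ℕ :=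
  sweepColumn k (if t < 2 * k + 1 then t else t - (2 * k + 1))

theorem sweepColumn_zero (k : ℕ) : sweepColumn k 0 = k := rfl

theorem sweepColumn_odd (k i : ℕ) : sweepColumn k (2 * i + 1) = k + 1 + i := by
  rw [sweepColumn, if_neg (by omega), if_pos (by omega)]
  omega

theorem sweepColumn_even (k i : ℕ) : sweepColumn k (2 * (i + 1)) = i := by
  rw [sweepColumn, if_neg (by omega), if_neg (by omega)]
  omega

theorem sweepColumn_lt {k s : ℕ} (hs : s < 2 * k + 1) : sweepColumn k s < 2 * k + 1 := by
  unfold sweepColumn; split_ifs <;> omega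

theorem sweepColumn_inj {k s t : ℕ} (hs : s < 2 * k + 1) (ht : t < 2 * k + 1)
    (h : sweepColumn k s = sweepColumn k t) : s = t := by
  unfold sweepColumn at h; split_ifs at h <;> omega

theorem doubleSweepColumn_lt {k t : ℕ} (ht : t < 2 * (2 * k + 1)) :
    doubleSweepColumn k t < 2 * k + 1 :=
  sweepColumn_lt (by split_ifs <;> omega)

/-- The vertex visited at time `t`: the rows alternate while the columns are swept twice. -/
def doubleSweep (k : ℕ) (t : Fin (2 * (2 * k + 1))) : Fin 2 × Fin (2 * k + 1) :=
  (⟨t % 2, Nat.mod_lt _ two_pos⟩, ⟨doubleSweepColumn k t, doubleSweepColumn_lt t.2⟩)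

theorem doubleSweep_injective (k : ℕ) : Function.Injective (doubleSweep k) := by
  rintro ⟨s, hs⟩ ⟨t, ht⟩ h
  simp only [doubleSweep, Prod.mk.injEq, Fin.mk.injEq] at h
  obtain ⟨hrow, hcol⟩ := h
  have := sweepColumn_inj (by split_ifs <;> omega) (by split_ifs <;> omega) hcol
  rw [Fin.mk.injEq]
  split_ifs at this <;> omega

theorem doubleSweep_bijective (k : ℕ) : Function.Bijective (doubleSweep k) :=
  (Fintype.bijective_iff_injective_and_card _).2 ⟨doubleSweep_injective k, by simp⟩

theorem dist_mod_two_succ (t : ℕ) : Nat.dist (t % 2) ((t + 1) % 2) = 1 := by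
  unfold Nat.dist; omega

theorem sum_dist_sweepColumn (k j : ℕ) :
    ∑ s ∈ Finset.range (2 * (j + 1)),
      (1 + Nat.dist (sweepColumn k s) (sweepColumn k (s + 1))) =
      (j + 1) * (k + 2) + 2 + j * (k + 3) := by
  induction j with
  | zero =>
    simp [Finset.sum_range_succ, sweepColumn, Nat.dist]
    omega
  | succ j ih =>
    rw [show 2 * (j + 1 + 1) = 2 * (j + 1) + 1 + 1 by ring, Finset.sum_range_succ,
      Finset.sum_range_succ, ih]
    have heven : Nat.dist (sweepColumn k (2 * (j + 1))) (sweepColumn k (2 * (j + 1) + 1)) =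
        k + 2 := by
      rw [sweepColumn_even, sweepColumn_odd]
      unfold Nat.dist
      omega
    have hodd : Nat.dist (sweepColumn k (2 * (j + 1) + 1)) (sweepColumn k (2 * (j + 1) + 1 + 1)) =
        k + 1 := by
      rw [sweepColumn_odd, show 2 * (j + 1) + 1 + 1 = 2 * (j + 1 + 1) by ring, sweepColumn_even]
      unfold Nat.dist
      omega
    rw [heven, hodd]
    ring

theorem sum_dist_doubleSweepColumn (k : ℕ) :
    ∑ t ∈ Finset.range (4 * (k + 1) + 1),
      (1 + Nat.dist (doubleSweepColumn (k + 1) t) (doubleSweepColumn (k + 1) (t + 1))) =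
      4 * (k + 1) ^ 2 + 8 * (k + 1) := by
  rw [show 4 * (k + 1) + 1 = 2 * (k + 1) + 1 + 2 * (k + 1) by ring, Finset.sum_range_add,
    Finset.sum_range_succ]
  have hfirst : ∀ s ∈ Finset.range (2 * (k + 1)),
      1 + Nat.dist (doubleSweepColumn (k + 1) s) (doubleSweepColumn (k + 1) (s + 1)) =
      1 + Nat.dist (sweepColumn (k + 1) s) (sweepColumn (k + 1) (s + 1)) := by
    intro s hs
    rw [Finset.mem_range] at hs
    rw [doubleSweepColumn, doubleSweepColumn, if_pos (by omega), if_pos (by omega)]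
  have hsecond : ∀ s ∈ Finset.range (2 * (k + 1)),
      1 + Nat.dist (doubleSweepColumn (k + 1) (2 * (k + 1) + 1 + s))
        (doubleSweepColumn (k + 1) (2 * (k + 1) + 1 + s + 1)) =
      1 + Nat.dist (sweepColumn (k + 1) s) (sweepColumn (k + 1) (s + 1)) := by
    intro s _
    rw [doubleSweepColumn, doubleSweepColumn, if_neg (by omega), if_neg (by omega), add_assoc _ s,
      Nat.add_sub_cancel_left, Nat.add_sub_cancel_left]
  have hmid : Nat.dist (doubleSweepColumn (k + 1) (2 * (k + 1)))
      (doubleSweepColumn (k + 1) (2 * (k + 1) + 1)) = 1 := by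
    rw [doubleSweepColumn, doubleSweepColumn, if_pos (by omega), if_neg (by omega),
      sweepColumn_even, Nat.sub_self, sweepColumn_zero]
    unfold Nat.dist
    omega
  rw [Finset.sum_congr rfl hfirst, Finset.sum_congr rfl hsecond, hmid, sum_dist_sweepColumn]
  ring

theorem exists_walk_two_rows (n : ℕ) (hn : 2 ≤ n) (hno : Odd n) :
    ∃ σ : Fin 2 × Fin n ≃ Fin (2 * n),
      walkLen 2 n σ = (n + 1) ^ 2 - 4 := by
  obtain ⟨_ | k, rfl⟩ := hno
  · omega
  refine ⟨(Equiv.ofBijective _ (doubleSweep_bijective (k + 1))).symm, ?_⟩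
  simp only [walkLen, Equiv.symm_symm, Equiv.ofBijective_apply, gridDist, doubleSweep,
    Fin.val_castLE, dist_mod_two_succ]
  rw [Fin.sum_univ_eq_sum_range (fun t ↦ 1 + Nat.dist (doubleSweepColumn (k + 1) t)
    (doubleSweepColumn (k + 1) (t + 1))),
    show 2 * (2 * (k + 1) + 1) - 1 = 4 * (k + 1) + 1 by omega, sum_dist_doubleSweepColumn]
  refine (Nat.sub_eq_of_eq_add ?_).symm
  ring
end

section
/- Let m, n ≥ 2 be natural numbers, both even. Then there exists a bijection σ : V → [mn], where V = {(i,j) : i ∈ [m], j ∈ [n]}, such that Σ_{t=1}^{mn−1} d(σ⁻¹(t), σ⁻¹(t+1)) = mn(m+n)/2 − 3. -/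
/-- A walk on the `2a × 2b` grid that alternates between two opposite quadrants during its first
`2ab` steps, and between the other two quadrants afterwards. -/
def quadrantWalk (a b t : ℕ) : ℕ × ℕ :=
  if t < 2 * (a * b) then
    if t % 2 = 0 then (a - 1 - t / 2 / b, b - 1 - t / 2 % b)
    else (a + t / 2 / b, 2 * b - 1 - t / 2 % b)
  else
    if t % 2 = 0 then ((t / 2 - a * b) / b, b + (t / 2 - a * b) % b)
    else (2 * a - 1 - (t / 2 - a * b) / b, (t / 2 - a * b) % b)

/-- Twice the Manhattan distance from `p` to the centre of the `2a × 2b` grid. -/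
def centreDist (a b : ℕ) (p : ℕ × ℕ) : ℕ :=
  Nat.dist (2 * p.1 + 1) (2 * a) + Nat.dist (2 * p.2 + 1) (2 * b)

lemma div_lt_and_mod_lt {a b k : ℕ} (hk : k < a * b) : k / b < a ∧ k % b < b := by
  have hb : 0 < b := Nat.pos_of_ne_zero (by rintro rfl; simp at hk)
  exact ⟨(Nat.div_lt_iff_lt_mul hb).2 hk, Nat.mod_lt _ hb⟩

lemma div_and_mod_of_succ_eq_mul {a b k : ℕ} (hk : k + 1 = a * b) :
    k / b + 1 = a ∧ k % b + 1 = b := by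
  have hb : 0 < b := Nat.pos_of_ne_zero (by rintro rfl; simp at hk)
  obtain ⟨h₁, h₂⟩ := div_lt_and_mod_lt (a := a) (b := b) (k := k) (by omega)
  have h := Nat.div_add_mod k b
  have hq : k / b + 1 = a := by
    by_contra hne
    have : (k / b + 2) * b ≤ a * b := Nat.mul_le_mul_right b (by omega)
    nlinarith
  refine ⟨hq, ?_⟩
  rw [← hq] at hk
  nlinarith

lemma quadrantWalk_lt {a b t : ℕ} (ht : t < 4 * (a * b)) :
    (quadrantWalk a b t).1 < 2 * a ∧ (quadrantWalk a b t).2 < 2 * b := by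
  unfold quadrantWalk
  split_ifs
  all_goals first
    | (have := div_lt_and_mod_lt (a := a) (b := b) (k := t / 2) (by omega)
       generalize t / 2 / b = x, t / 2 % b = y at *
       dsimp only; omega)
    | (have := div_lt_and_mod_lt (a := a) (b := b) (k := t / 2 - a * b) (by omega)
       generalize (t / 2 - a * b) / b = x, (t / 2 - a * b) % b = y at *
       dsimp only; omega)

lemma quadrantWalk_injOn (a b : ℕ) : Set.InjOn (quadrantWalk a b) {t | t < 4 * (a * b)} := by
  intro s hs t ht hst
  change s < _ at hs
  change t < _ at ht
  obtain ⟨k, hk, hkN⟩ : ∃ k, k = (if s < 2 * (a * b) then s / 2 else s / 2 - a * b) ∧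
      k < a * b := ⟨_, rfl, by split_ifs <;> omega⟩
  obtain ⟨l, hl, hlN⟩ : ∃ l, l = (if t < 2 * (a * b) then t / 2 else t / 2 - a * b) ∧
      l < a * b := ⟨_, rfl, by split_ifs <;> omega⟩
  have hk' := div_lt_and_mod_lt hkN
  have hl' := div_lt_and_mod_lt hlN
  have key : k / b = l / b → k % b = l % b → k = l := fun h₁ h₂ => by
    rw [← Nat.div_add_mod k b, ← Nat.div_add_mod l b, h₁, h₂]
  unfold quadrantWalk at hst
  split_ifs at hk hl hst <;> simp only [← hk, ← hl, Prod.mk.injEq] at hst <;>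
    generalize k / b = x, k % b = y, l / b = z, l % b = w at * <;>
    omega

lemma two_mul_dist_quadrantWalk {a b t : ℕ} (ht : t + 1 < 4 * (a * b)) :
    2 * (Nat.dist (quadrantWalk a b t).1 (quadrantWalk a b (t + 1)).1 +
        Nat.dist (quadrantWalk a b t).2 (quadrantWalk a b (t + 1)).2) +
        (if t = 2 * (a * b) - 1 then 2 else 0) =
      centreDist a b (quadrantWalk a b t) + centreDist a b (quadrantWalk a b (t + 1)) := by
  by_cases hmid : t = 2 * (a * b) - 1
  · obtain ⟨h₁, h₂⟩ := div_and_mod_of_succ_eq_mul (a := a) (b := b) (k := t / 2) (by omega)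
    have hz : (t + 1) / 2 - a * b = 0 := by omega
    simp only [quadrantWalk, centreDist, Nat.dist, if_pos hmid,
      if_pos (show t < 2 * (a * b) by omega), if_neg (show ¬ t % 2 = 0 by omega),
      if_neg (show ¬ t + 1 < 2 * (a * b) by omega), if_pos (show (t + 1) % 2 = 0 by omega),
      hz, Nat.zero_div, Nat.zero_mod]
    omega
  · rw [if_neg hmid]
    by_cases h : t < 2 * (a * b)
    · have h₁ := div_lt_and_mod_lt (a := a) (b := b) (k := t / 2) (by omega)
      have h₂ := div_lt_and_mod_lt (a := a) (b := b) (k := (t + 1) / 2) (by omega)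
      simp only [quadrantWalk, centreDist, Nat.dist, if_pos h,
        if_pos (show t + 1 < 2 * (a * b) by omega)]
      generalize t / 2 / b = x, t / 2 % b = y, (t + 1) / 2 / b = z, (t + 1) / 2 % b = w at *
      split_ifs <;> dsimp only <;> omega
    · have h₁ := div_lt_and_mod_lt (a := a) (b := b) (k := t / 2 - a * b) (by omega)
      have h₂ := div_lt_and_mod_lt (a := a) (b := b) (k := (t + 1) / 2 - a * b) (by omega)
      simp only [quadrantWalk, centreDist, Nat.dist, if_neg h,
        if_neg (show ¬ t + 1 < 2 * (a * b) by omega)]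
      generalize (t / 2 - a * b) / b = x, (t / 2 - a * b) % b = y,
        ((t + 1) / 2 - a * b) / b = z, ((t + 1) / 2 - a * b) % b = w at *
      split_ifs <;> dsimp only <;> omega

lemma centreDist_quadrantWalk_zero {a b : ℕ} (ha : 0 < a) (hb : 0 < b) :
    centreDist a b (quadrantWalk a b 0) = 2 := by
  have := Nat.mul_pos ha hb
  simp only [quadrantWalk, centreDist, Nat.dist, if_pos (show 0 < 2 * (a * b) by omega),
    Nat.zero_mod, Nat.zero_div, if_true]
  omega

lemma centreDist_quadrantWalk_last {a b : ℕ} (ha : 0 < a) (hb : 0 < b) :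
    centreDist a b (quadrantWalk a b (4 * (a * b) - 1)) = 2 := by
  have := Nat.mul_pos ha hb
  obtain ⟨h₁, h₂⟩ := div_and_mod_of_succ_eq_mul (a := a) (b := b)
    (k := (4 * (a * b) - 1) / 2 - a * b) (by omega)
  simp only [quadrantWalk, centreDist, Nat.dist,
    if_neg (show ¬ 4 * (a * b) - 1 < 2 * (a * b) by omega),
    if_neg (show ¬ (4 * (a * b) - 1) % 2 = 0 by omega)]
  omega

lemma sum_dist_centre (a : ℕ) :
    ∑ i : Fin (2 * a), Nat.dist (2 * (i : ℕ) + 1) (2 * a) = 2 * a ^ 2 := by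
  rw [← Finset.sum_range fun i => Nat.dist (2 * i + 1) (2 * a), two_mul a, Finset.sum_range_add,
    ← Finset.sum_range_reflect]
  have odd_sum : ∑ x ∈ Finset.range a, (2 * x + 1) = a ^ 2 := by
    induction a with
    | zero => simp
    | succ k ih => rw [Finset.sum_range_succ, ih]; ring
  rw [two_mul, ← odd_sum]
  congr 1 <;> refine Finset.sum_congr rfl fun x hx => ?_ <;>
    rw [Finset.mem_range] at hx <;> simp only [Nat.dist] <;> omega

lemma sum_centreDist (a b : ℕ) :
    ∑ p : Fin (2 * a) × Fin (2 * b), centreDist a b (p.1, p.2) = 4 * (a * b) * (a + b) := by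
  simp only [centreDist, Finset.sum_add_distrib, Fintype.sum_prod_type, Finset.sum_const,
    sum_dist_centre, Finset.card_univ, Fintype.card_fin, smul_eq_mul, ← Finset.mul_sum]
  ring

lemma sum_range_add_succ (f : ℕ → ℕ) (K : ℕ) :
    ∑ t ∈ Finset.range K, (f t + f (t + 1)) + f 0 + f K =
      2 * ∑ t ∈ Finset.range (K + 1), f t := by
  rw [Finset.sum_add_distrib, two_mul]
  nth_rewrite 2 [Finset.sum_range_succ']
  rw [Finset.sum_range_succ]
  ring

theorem exists_walk_even_even (m n : ℕ) (hm : 2 ≤ m) (hn : 2 ≤ n)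
    (hme : Even m) (hne : Even n) :
    ∃ σ : Fin m × Fin n ≃ Fin (m * n),
      walkLen m n σ = m * n * (m + n) / 2 - 3 := by
  obtain ⟨a, rfl⟩ := hme.two_dvd
  obtain ⟨b, rfl⟩ := hne.two_dvd
  have ha : 0 < a := by omega
  have hb : 0 < b := by omega
  have hN := Nat.mul_pos ha hb
  have hcard : 2 * a * (2 * b) = 4 * (a * b) := by ring
  let τ : Fin (2 * a * (2 * b)) → Fin (2 * a) × Fin (2 * b) := fun t =>
    have h := quadrantWalk_lt (a := a) (b := b) (t := t) (hcard ▸ t.isLt)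
    (⟨_, h.1⟩, ⟨_, h.2⟩)
  have hτ : Function.Bijective τ := by
    refine (Fintype.bijective_iff_injective_and_card τ).2 ⟨fun s t hst => ?_, by simp⟩
    simp only [τ, Prod.mk.injEq, Fin.mk.injEq] at hst
    exact Fin.ext (quadrantWalk_injOn a b (hcard ▸ s.isLt) (hcard ▸ t.isLt)
      (Prod.ext hst.1 hst.2))
  refine ⟨(Equiv.ofBijective τ hτ).symm, ?_⟩
  let c : ℕ → ℕ := fun t => centreDist a b (quadrantWalk a b t)
  let d : ℕ → ℕ := fun t => Nat.dist (quadrantWalk a b t).1 (quadrantWalk a b (t + 1)).1 +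
    Nat.dist (quadrantWalk a b t).2 (quadrantWalk a b (t + 1)).2
  have hlen : walkLen (2 * a) (2 * b) (Equiv.ofBijective τ hτ).symm =
      ∑ t ∈ Finset.range (4 * (a * b) - 1), d t := by
    rw [← hcard, Finset.sum_range d]
    rfl
  have hc : ∑ t ∈ Finset.range (4 * (a * b) - 1 + 1), c t = 4 * (a * b) * (a + b) := by
    rw [Nat.sub_add_cancel (by omega), ← sum_centreDist a b, ← hcard, Finset.sum_range c]
    exact (Equiv.ofBijective τ hτ).sum_comp fun p => centreDist a b (p.1, p.2)
  have hd : 2 * ∑ t ∈ Finset.range (4 * (a * b) - 1), d t + 2 =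
      ∑ t ∈ Finset.range (4 * (a * b) - 1), (c t + c (t + 1)) := by
    calc
      _ = ∑ t ∈ Finset.range (4 * (a * b) - 1),
          (2 * d t + if t = 2 * (a * b) - 1 then 2 else 0) := by
        rw [Finset.mul_sum, Finset.sum_add_distrib, Finset.sum_ite_eq',
          if_pos (by rw [Finset.mem_range]; omega)]
      _ = _ := Finset.sum_congr rfl fun t ht =>
        two_mul_dist_quadrantWalk (by rw [Finset.mem_range] at ht; omega)
  have h := sum_range_add_succ c (4 * (a * b) - 1)
  rw [← hd, hc, show c 0 = 2 from centreDist_quadrantWalk_zero ha hb,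
    show c (4 * (a * b) - 1) = 2 from centreDist_quadrantWalk_last ha hb] at h
  have hrhs : 2 * a * (2 * b) * (2 * a + 2 * b) = 2 * (4 * (a * b) * (a + b)) := by ring
  rw [hlen, hrhs]
  omega
end
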